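/- Let (X,d) be an extended metric space, let a < b, and let u : [a,b] → X be absolutely continuous, i.e. there exists a nonnegative m ∈ L¹(a,b) with d(u(s),u(t)) ≤ ∫_s^t m(r) dr for all a ≤ s < t ≤ b. Then for Lebesgue-a.e. t ∈ (a,b) the limit |u̇|_d(t) := lim_{τ→0} d(u(t+τ),u(t))/|τ| exists and is finite; the function |u̇|_d belongs to L¹(a,b), satisfies |u̇|_d(t) ≤ m(t) for a.e. t for every admissible m, and is itself admissible: d(u(s),u(t)) ≤ ∫_s^t |u̇|_d(r) dr for all a ≤ s < t ≤ b. In particular |u̇|_d is the a.e.-minimal admissible function. -/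

import Mathlib

open MeasureTheory Filter Topology

/-- A function whose increments on an interval are dominated by those of an absolutely continuous
function is absolutely continuous. -/
theorem AbsolutelyContinuousOnInterval.of_dist_le {E F : Type*} [PseudoMetricSpace E]
    [PseudoMetricSpace F] {f : ℝ → E} {g : ℝ → F} {a b : ℝ}
    (hg : AbsolutelyContinuousOnInterval g a b)
    (hfg : ∀ s ∈ Set.uIcc a b, ∀ t ∈ Set.uIcc a b, dist (f s) (f t) ≤ dist (g s) (g t)) :
    AbsolutelyContinuousOnInterval f a b := by
  rw [absolutelyContinuousOnInterval_iff] at hg ⊢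
  intro ε hε
  obtain ⟨δ, hδ, H⟩ := hg ε hε
  refine ⟨δ, hδ, fun E hE hlen => (Finset.sum_le_sum fun i hi => ?_).trans_lt (H E hE hlen)⟩
  exact hfg _ (hE.1 i hi).1 _ (hE.1 i hi).2

/-- The absolute difference quotients of a differentiable function converge to the absolute value
of the derivative. -/
theorem HasDerivAt.tendsto_abs_sub_div {f : ℝ → ℝ} {f' t : ℝ} (hf : HasDerivAt f f' t) :
    Tendsto (fun τ : ℝ => |f (t + τ) - f t| / |τ|) (𝓝[≠] 0) (𝓝 |f'|) := by
  have h := hf.tendsto_slope_zero.abs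
  refine h.congr fun τ => ?_
  rw [smul_eq_mul, abs_mul, abs_inv, div_eq_inv_mul]

theorem abs_deriv_le_abs_of_hasDerivAt {f g : ℝ → ℝ} {g' t : ℝ} (hg : HasDerivAt g g' t)
    (hfg : ∀ᶠ τ in 𝓝[≠] (0 : ℝ), |f (t + τ) - f t| ≤ |g (t + τ) - g t|) :
    |deriv f t| ≤ |g'| := by
  by_cases hf : DifferentiableAt ℝ f t
  · refine le_of_tendsto_of_tendsto hf.hasDerivAt.tendsto_abs_sub_div hg.tendsto_abs_sub_div ?_
    filter_upwards [hfg] with τ hτ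
    gcongr
  · simp [deriv_zero_of_not_differentiableAt hf]

theorem eventually_add_mem_Icc {a b t : ℝ} (ht : t ∈ Set.Ioo a b) :
    ∀ᶠ τ in 𝓝[≠] (0 : ℝ), t + τ ∈ Set.Icc a b := by
  have hc : Tendsto (fun τ : ℝ => t + τ) (𝓝 0) (𝓝 t) := by
    simpa using (continuous_const_add t).tendsto 0
  exact (hc.eventually (Icc_mem_nhds ht.1 ht.2)).filter_mono nhdsWithin_le_nhds

/-- Increments dominated by an integral force the derivative to be dominated by the integrand. -/
theorem ae_abs_deriv_le_of_abs_sub_le_integral {a b : ℝ} {f m : ℝ → ℝ}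
    (hm0 : ∀ r ∈ Set.Ioo a b, 0 ≤ m r) (hm : IntervalIntegrable m volume a b)
    (hfm : ∀ s ∈ Set.Icc a b, ∀ t ∈ Set.Icc a b, |f t - f s| ≤ |∫ r in s..t, m r|) :
    ∀ᵐ t ∂(volume.restrict (Set.Ioo a b)), |deriv f t| ≤ m t := by
  rw [ae_restrict_iff' measurableSet_Ioo]
  filter_upwards [hm.ae_hasDerivAt_integral] with t hder ht
  have htI : t ∈ Set.Icc a b := Set.Ioo_subset_Icc_self ht
  have hd := hder (Set.Icc_subset_uIcc htI) t (Set.Icc_subset_uIcc htI)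
  have h := abs_deriv_le_abs_of_hasDerivAt (f := f) hd <| by
    filter_upwards [eventually_add_mem_Icc ht] with τ hτ
    simpa using hfm t htI _ hτ
  rwa [abs_of_nonneg (hm0 t ht)] at h

/-- The metric derivative for a real-valued pseudodistance `D` on `[a, b]` that is dominated by the
integral of `m`. -/
theorem exists_metric_derivative_real {a b : ℝ} (hab : a < b) {D : ℝ → ℝ → ℝ} {m : ℝ → ℝ}
    (hsymm : ∀ s t, D s t = D t s)
    (htri : ∀ r ∈ Set.Icc a b, ∀ s ∈ Set.Icc a b, ∀ t ∈ Set.Icc a b, D r t ≤ D r s + D s t)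
    (hm0 : ∀ r ∈ Set.Ioo a b, 0 ≤ m r) (hm : IntervalIntegrable m volume a b)
    (hDm : ∀ s ∈ Set.Icc a b, ∀ t ∈ Set.Icc a b, D s t ≤ |∫ r in s..t, m r|) :
    ∃ v : ℝ → ℝ, (∀ r, 0 ≤ v r) ∧ IntervalIntegrable v volume a b ∧
      (∀ᵐ t ∂(volume.restrict (Set.Ioo a b)),
        Tendsto (fun τ : ℝ => D (t + τ) t / |τ|) (𝓝[≠] 0) (𝓝 (v t))) ∧
      (∀ s ∈ Set.Icc a b, ∀ t ∈ Set.Icc a b, s ≤ t → D s t ≤ ∫ r in s..t, v r) ∧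
      (∀ m' : ℝ → ℝ, (∀ r ∈ Set.Ioo a b, 0 ≤ m' r) → IntervalIntegrable m' volume a b →
        (∀ s ∈ Set.Icc a b, ∀ t ∈ Set.Icc a b, D s t ≤ |∫ r in s..t, m' r|) →
        ∀ᵐ t ∂(volume.restrict (Set.Ioo a b)), v t ≤ m' t) := by
  have hne : Nonempty (Set.Icc a b) := ⟨⟨a, Set.left_mem_Icc.2 hab.le⟩⟩
  have hIcc : Set.uIcc a b = Set.Icc a b := Set.uIcc_of_le hab.le
  have hsub : ∀ s ∈ Set.Icc a b, ∀ t ∈ Set.Icc a b, Set.uIcc s t ⊆ Set.uIcc a b := by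
    intro s hs t ht
    rw [hIcc]
    exact Set.uIcc_subset_Icc hs ht
  let x : ℕ → Set.Icc a b := TopologicalSpace.denseSeq (Set.Icc a b)
  let f : ℕ → ℝ → ℝ := fun n t => D (x n) t
  let v : ℝ → ℝ := fun t => ⨆ n, |deriv (f n) t|
  have hfD : ∀ n, ∀ s ∈ Set.Icc a b, ∀ t ∈ Set.Icc a b, |f n t - f n s| ≤ D s t := by
    intro n s hs t ht
    have h1 := htri _ (x n).2 s hs t ht
    have h2 := htri _ (x n).2 t ht s hs
    have h3 := hsymm s t
    simp only [f]
    rw [abs_le]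
    constructor <;> linarith
  have hfac : ∀ n, AbsolutelyContinuousOnInterval (f n) a b := by
    intro n
    have hM := hm.absolutelyContinuousOnInterval_intervalIntegral (c := a) Set.left_mem_uIcc
    refine hM.of_dist_le fun s hs t ht => ?_
    rw [dist_comm, Real.dist_eq, dist_comm, Real.dist_eq]
    have hai : ∀ y ∈ Set.uIcc a b, IntervalIntegrable m volume a y := fun y hy =>
      hm.mono_set (Set.uIcc_subset_uIcc Set.left_mem_uIcc hy)
    rw [intervalIntegral.integral_interval_sub_left (hai t ht) (hai s hs)]
    rw [hIcc] at hs ht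
    exact (hfD n s hs t ht).trans (hDm s hs t ht)
  have hbound : ∀ m' : ℝ → ℝ, (∀ r ∈ Set.Ioo a b, 0 ≤ m' r) →
      IntervalIntegrable m' volume a b →
      (∀ s ∈ Set.Icc a b, ∀ t ∈ Set.Icc a b, D s t ≤ |∫ r in s..t, m' r|) →
      ∀ᵐ t ∂(volume.restrict (Set.Ioo a b)), ∀ n, |deriv (f n) t| ≤ m' t := by
    intro m' hm'0 hm' hDm'
    rw [ae_all_iff]
    exact fun n => ae_abs_deriv_le_of_abs_sub_le_integral hm'0 hm' fun s hs t ht =>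
      (hfD n s hs t ht).trans (hDm' s hs t ht)
  have hv0 : ∀ r, 0 ≤ v r := fun r => Real.iSup_nonneg fun n => abs_nonneg _
  have hfv : ∀ᵐ t ∂(volume.restrict (Set.Ioo a b)), ∀ n, |deriv (f n) t| ≤ v t := by
    filter_upwards [hbound m hm0 hm hDm] with t ht n
    exact le_ciSup (f := fun n => |deriv (f n) t|) ⟨m t, by rintro _ ⟨k, rfl⟩; exact ht k⟩ n
  have hvm : ∀ᵐ t ∂(volume.restrict (Set.Ioo a b)), v t ≤ m t := by
    filter_upwards [hbound m hm0 hm hDm] with t ht using ciSup_le ht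
  have hvmeas : Measurable v := Measurable.iSup fun n => (measurable_deriv (f n)).abs
  have hvint : IntervalIntegrable v volume a b := by
    rw [intervalIntegrable_iff_integrableOn_Ioo_of_le hab.le] at hm ⊢
    refine Integrable.mono' hm hvmeas.aestronglyMeasurable ?_
    filter_upwards [hvm] with t ht
    rwa [Real.norm_of_nonneg (hv0 t)]
  have hvD : ∀ s ∈ Set.Icc a b, ∀ t ∈ Set.Icc a b, s ≤ t → D s t ≤ ∫ r in s..t, v r := by
    intro s hs t ht hst
    have hfn : ∀ n, f n t - f n s ≤ ∫ r in s..t, v r := by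
      intro n
      have hac := (hfac n).mono (hsub s hs t ht)
      rw [← hac.integral_deriv_eq_sub]
      refine intervalIntegral.integral_mono_ae_restrict hst hac.intervalIntegrable_deriv
        (hvint.mono_set (hsub s hs t ht)) ?_
      rw [← Measure.restrict_congr_set Ioo_ae_eq_Icc]
      refine ae_restrict_of_ae_restrict_of_subset (Set.Ioo_subset_Ioo hs.1 ht.2) ?_
      filter_upwards [hfv] with r hr using (le_abs_self _).trans (hr n)
    have hcont : Continuous fun y : Set.Icc a b => ∫ r in s..(y : ℝ), m r := by
      have := intervalIntegral.continuousOn_primitive_interval'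
        hm (a := s) (hIcc ▸ hs)
      rw [hIcc] at this
      exact this.domRestrict
    have key : ∀ y : Set.Icc a b, D s t ≤ 2 * |∫ r in s..(y : ℝ), m r| + ∫ r in s..t, v r := by
      intro y
      refine (TopologicalSpace.denseRange_denseSeq (Set.Icc a b)).induction_on
        (p := fun y : Set.Icc a b =>
          D s t ≤ 2 * |∫ r in s..(y : ℝ), m r| + ∫ r in s..t, v r) y
        (isClosed_le continuous_const (by fun_prop)) fun n => ?_
      have h1 := htri s hs _ (x n).2 t ht
      have h2 := hDm s hs _ (x n).2
      have h3 := hfn n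
      have h4 := hsymm s (x n)
      simp only [f] at h3
      change D s t ≤ 2 * |∫ r in s..(x n : ℝ), m r| + ∫ r in s..t, v r
      linarith
    simpa using key ⟨s, hs⟩
  refine ⟨v, hv0, hvint, ?_, hvD, fun m' hm'0 hm' hDm' => ?_⟩
  · have hdiff : ∀ᵐ t, ∀ n, t ∈ Set.uIcc a b → DifferentiableAt ℝ (f n) t :=
      ae_all_iff.2 fun n => (hfac n).ae_differentiableAt
    filter_upwards [ae_restrict_of_ae hdiff, ae_restrict_of_ae hvint.ae_hasDerivAt_integral,
      ae_restrict_mem measurableSet_Ioo] with t htd htv ht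
    have htI : t ∈ Set.Icc a b := Set.Ioo_subset_Icc_self ht
    have htU : t ∈ Set.uIcc a b := Set.Icc_subset_uIcc htI
    refine tendsto_order.2 ⟨fun c hc => ?_, fun c hc => ?_⟩
    · obtain ⟨n, hn⟩ := exists_lt_of_lt_ciSup hc
      filter_upwards [(htd n htU).hasDerivAt.tendsto_abs_sub_div.eventually_const_lt hn,
        eventually_add_mem_Icc ht] with τ hτ hτI
      refine hτ.trans_le ?_
      rw [hsymm]
      gcongr
      exact hfD n t htI _ hτI
    · have hlim := (htv htU t htU).tendsto_abs_sub_div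
      rw [abs_of_nonneg (hv0 t)] at hlim
      filter_upwards [hlim.eventually_lt_const hc, eventually_add_mem_Icc ht] with τ hτ hτI
      refine lt_of_le_of_lt ?_ hτ
      gcongr
      rw [intervalIntegral.integral_same, sub_zero]
      rcases le_total t (t + τ) with h | h
      · rw [hsymm]
        exact (hvD t htI _ hτI h).trans (le_abs_self _)
      · rw [intervalIntegral.integral_symm, abs_neg]
        exact (hvD _ hτI t htI h).trans (le_abs_self _)
  · filter_upwards [hbound m' hm'0 hm' hDm'] with t ht using ciSup_le ht

/-- Existence of the metric derivative of an absolutely continuous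
curve in an extended metric space `(X, d)`: there is a nonnegative integrable function
`v` on `(a,b)` which is the a.e. limit of the difference quotients
`d(u(t+τ),u(t))/|τ|`, which is admissible (`d(u(s),u(t)) ≤ ∫_s^t v`), and which is
a.e. below every admissible function `m`. -/
theorem metric_derivative_exists
    {X : Type*} (d : X → X → ENNReal)
    (hd0 : ∀ x y : X, d x y = 0 ↔ x = y)
    (hdsymm : ∀ x y : X, d x y = d y x)
    (hdtri : ∀ x y z : X, d x z ≤ d x y + d y z)
    (a b : ℝ) (hab : a < b) (u : ℝ → X) (m : ℝ → ℝ)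
    (hmnn : ∀ r ∈ Set.Ioo a b, 0 ≤ m r) (hmint : IntegrableOn m (Set.Ioo a b))
    (hadm : ∀ s t : ℝ, a ≤ s → s < t → t ≤ b →
      d (u s) (u t) ≤ ENNReal.ofReal (∫ r in s..t, m r)) :
    ∃ v : ℝ → ℝ, (∀ r ∈ Set.Ioo a b, 0 ≤ v r) ∧ IntegrableOn v (Set.Ioo a b) ∧
      (∀ᵐ t ∂(volume.restrict (Set.Ioo a b)),
        Tendsto (fun τ : ℝ => d (u (t + τ)) (u t) / ENNReal.ofReal |τ|) (𝓝[≠] 0)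
          (𝓝 (ENNReal.ofReal (v t)))) ∧
      (∀ᵐ t ∂(volume.restrict (Set.Ioo a b)), v t ≤ m t) ∧
      (∀ s t : ℝ, a ≤ s → s < t → t ≤ b →
        d (u s) (u t) ≤ ENNReal.ofReal (∫ r in s..t, v r)) ∧
      (∀ m' : ℝ → ℝ, (∀ r ∈ Set.Ioo a b, 0 ≤ m' r) → IntegrableOn m' (Set.Ioo a b) →
        (∀ s t : ℝ, a ≤ s → s < t → t ≤ b →
          d (u s) (u t) ≤ ENNReal.ofReal (∫ r in s..t, m' r)) →
        ∀ᵐ t ∂(volume.restrict (Set.Ioo a b)), v t ≤ m' t) := by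
  have hself : ∀ s, d (u s) (u s) = 0 := fun s => (hd0 _ _).2 rfl
  have hle : ∀ m' : ℝ → ℝ, (∀ s t : ℝ, a ≤ s → s < t → t ≤ b →
      d (u s) (u t) ≤ ENNReal.ofReal (∫ r in s..t, m' r)) →
      ∀ s ∈ Set.Icc a b, ∀ t ∈ Set.Icc a b,
        d (u s) (u t) ≤ ENNReal.ofReal |∫ r in s..t, m' r| := by
    intro m' hm' s hs t ht
    rcases lt_trichotomy s t with h | rfl | h
    · exact (hm' s t hs.1 h ht.2).trans (ENNReal.ofReal_le_ofReal (le_abs_self _))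
    · simp [hself]
    · rw [hdsymm, intervalIntegral.integral_symm, abs_neg]
      exact (hm' t s ht.1 h hs.2).trans (ENNReal.ofReal_le_ofReal (le_abs_self _))
  have hfin : ∀ s ∈ Set.Icc a b, ∀ t ∈ Set.Icc a b, d (u s) (u t) ≠ ⊤ := fun s hs t ht =>
    ne_top_of_le_ne_top ENNReal.ofReal_ne_top (hle m hadm s hs t ht)
  have hreal : ∀ m' : ℝ → ℝ, (∀ s t : ℝ, a ≤ s → s < t → t ≤ b →
      d (u s) (u t) ≤ ENNReal.ofReal (∫ r in s..t, m' r)) →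
      ∀ s ∈ Set.Icc a b, ∀ t ∈ Set.Icc a b,
        (d (u s) (u t)).toReal ≤ |∫ r in s..t, m' r| := fun m' hm' s hs t ht =>
    ENNReal.toReal_le_of_le_ofReal (abs_nonneg _) (hle m' hm' s hs t ht)
  have hint : ∀ {w : ℝ → ℝ}, IntervalIntegrable w volume a b ↔ IntegrableOn w (Set.Ioo a b) :=
    intervalIntegrable_iff_integrableOn_Ioo_of_le hab.le
  obtain ⟨v, hv0, hvint, hlim, hvD, hmin⟩ :=
    exists_metric_derivative_real hab (D := fun s t => (d (u s) (u t)).toReal) (m := m)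
      (fun s t => by rw [hdsymm])
      (fun r hr s hs t ht => by
        rw [← ENNReal.toReal_add (hfin r hr s hs) (hfin s hs t ht)]
        exact ENNReal.toReal_mono (ENNReal.add_ne_top.2 ⟨hfin r hr s hs, hfin s hs t ht⟩)
          (hdtri _ _ _))
      hmnn (hint.2 hmint) (hreal m hadm)
  refine ⟨v, fun r _ => hv0 r, hint.1 hvint, ?_, hmin m hmnn (hint.2 hmint) (hreal m hadm),
    fun s t hs hst ht => ?_, fun m' hm'0 hm' hadm' => hmin m' hm'0 (hint.2 hm') (hreal m' hadm')⟩
  · filter_upwards [hlim, ae_restrict_mem measurableSet_Ioo] with t htlim ht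
    refine (ENNReal.tendsto_ofReal htlim).congr' ?_
    filter_upwards [eventually_add_mem_Icc ht, self_mem_nhdsWithin] with τ hτ hτ0
    rw [ENNReal.ofReal_div_of_pos (abs_pos.2 hτ0),
      ENNReal.ofReal_toReal (hfin _ hτ t (Set.Ioo_subset_Icc_self ht))]
  · have hsI : s ∈ Set.Icc a b := ⟨hs, hst.le.trans ht⟩
    have htI : t ∈ Set.Icc a b := ⟨hs.trans hst.le, ht⟩
    rw [← ENNReal.ofReal_toReal (hfin s hsI t htI)]
    exact ENNReal.ofReal_le_ofReal (hvD s hsI t htI hst.le)
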